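/- arXiv:1402.6350 — 3 statements merged into one kernel-verified Lean document; each statement's English description precedes it below -/
import Mathlib

section
/- Smolyak combination identity (second assertion of Theorem 2, purely algebraic form): Let R be a commutative ring, let d ≥ 1 and η ≥ d be integers, and for each i = 1,…,d let u_{i,·} : ℕ → R be a sequence with u_{i,0} = 0. Then Σ_{j ∈ J(η)} ∏_{i=1}^d ( u_{i,j_i} − u_{i,j_i−1} ) = Σ_{j ∈ P(η)} (−1)^{η−|j|} · binom(d−1, η−|j|) · ∏_{i=1}^d u_{i,j_i}. -/
open Finset

/-- The index set `J(η)`: multi-indices with all entries at least 1 and `∑ j i ≤ η`. -/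
def idxJ (d η : ℕ) : Finset (Fin d → ℕ) :=
  (Fintype.piFinset fun _ : Fin d => Finset.Icc 1 η).filter fun j => ∑ i, j i ≤ η

/-- The index set `P(η)`: multi-indices with all entries at least 1 and
`max(d, η−d+1) ≤ ∑ j i ≤ η`. -/
def idxP (d η : ℕ) : Finset (Fin d → ℕ) :=
  (Fintype.piFinset fun _ : Fin d => Finset.Icc 1 η).filter fun j =>
    max d (η - d + 1) ≤ ∑ i, j i ∧ ∑ i, j i ≤ η

open PowerSeries in
/-- The coefficients of `(1 - X) ^ n` are signed binomial coefficients. -/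
theorem coeff_one_sub_X_pow {R : Type*} [CommRing R] (n k : ℕ) :
    coeff k ((1 - X : R⟦X⟧) ^ n) = (-1) ^ k * (n.choose k : R) := by
  have h : (1 - X : R⟦X⟧) ^ n = rescale (-1) ((1 + Polynomial.X : Polynomial R) ^ n : Polynomial R) := by
    simp [rescale_X, sub_eq_add_neg]
  rw [h, coeff_rescale, Polynomial.coeff_coe, Polynomial.coeff_one_add_X_pow]

theorem mem_idxJ {d η : ℕ} {j : Fin d → ℕ} :
    j ∈ idxJ d η ↔ (∀ i, 1 ≤ j i) ∧ ∑ i, j i ≤ η := by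
  simp only [idxJ, mem_filter, Fintype.mem_piFinset, mem_Icc]
  exact ⟨fun h ↦ ⟨fun i ↦ (h.1 i).1, h.2⟩, fun h ↦ ⟨fun i ↦ ⟨h.1 i,
    (single_le_sum (fun _ _ ↦ Nat.zero_le _) (mem_univ i)).trans h.2⟩, h.2⟩⟩

theorem idxP_eq_filter (d η : ℕ) :
    idxP d η = (idxJ d η).filter fun j ↦ max d (η - d + 1) ≤ ∑ i, j i := by
  ext j
  simp only [idxP, idxJ, mem_filter]
  tauto

open PowerSeries in
/-- For power series without constant term, a coefficient of `A * ∏ i, f i` only involves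
multi-indices in `idxJ`. -/
theorem sum_idxJ_coeff_mul_prod_coeff {R : Type*} [CommRing R] (d η : ℕ) (A : R⟦X⟧)
    (f : Fin d → R⟦X⟧) (hf : ∀ i, coeff 0 (f i) = 0) :
    ∑ j ∈ idxJ d η, coeff (η - ∑ i, j i) A * ∏ i, coeff (j i) (f i) =
      coeff η (A * ∏ i, f i) := by
  rw [mul_comm A, coeff_mul, Nat.sum_antidiagonal_eq_sum_range_succ_mk,
    ← sum_fiberwise_of_maps_to (t := range η.succ) (g := fun j ↦ ∑ i, j i)
      fun j hj ↦ mem_range.2 (Nat.lt_succ_of_le (mem_idxJ.1 hj).2)]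
  refine sum_congr rfl fun k hk ↦ ?_
  rw [coeff_prod, sum_mul]
  refine sum_bij_ne_zero (fun j _ _ ↦ Finsupp.equivFunOnFinite.symm j) ?_ ?_ ?_ ?_
  · intro j hj _
    simpa using (mem_filter.1 hj).2
  · intro j _ _ j' _ _ h
    exact Finsupp.equivFunOnFinite.symm.injective h
  · intro l hl h
    have hl' : ∑ i, l i = k := (mem_finsuppAntidiag.1 hl).1
    have hpos (i : Fin d) : 1 ≤ l i := by
      by_contra! hi
      refine h ?_
      rw [prod_eq_zero (mem_univ i), zero_mul]
      rw [Nat.lt_one_iff.1 hi, hf]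
    refine ⟨l, mem_filter.2 ⟨mem_idxJ.2 ⟨hpos, ?_⟩, hl'⟩, ?_, by ext; simp⟩
    · rw [hl']
      exact Nat.lt_succ_iff.1 (mem_range.1 hk)
    · rwa [hl', mul_comm]
  · intro j hj _
    rw [(mem_filter.1 hj).2, mul_comm]
    simp

/-- **Smolyak combination identity** (second assertion of Theorem 2, algebraic form). -/
theorem smolyak_combination_identity (R : Type*) [CommRing R] (d η : ℕ)
    (hd : 1 ≤ d) (hη : d ≤ η)
    (u : Fin d → ℕ → R) (hu : ∀ i, u i 0 = 0) :
    ∑ j ∈ idxJ d η, ∏ i : Fin d, (u i (j i) - u i (j i - 1)) =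
      ∑ j ∈ idxP d η,
        (-1 : R) ^ (η - ∑ i, j i) * ((d - 1).choose (η - ∑ i, j i) : R) *
          ∏ i : Fin d, u i (j i) := by
  have hP : ∑ j ∈ idxP d η, (-1 : R) ^ (η - ∑ i, j i) * ((d - 1).choose (η - ∑ i, j i) : R) *
        ∏ i : Fin d, u i (j i) =
      ∑ j ∈ idxJ d η, (-1 : R) ^ (η - ∑ i, j i) * ((d - 1).choose (η - ∑ i, j i) : R) *
        ∏ i : Fin d, u i (j i) := by
    rw [idxP_eq_filter]
    refine sum_subset (filter_subset _ _) fun j hj hj' ↦ ?_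
    have hdj : d ≤ ∑ i, j i := by
      simpa using card_nsmul_le_sum univ j 1 fun i _ ↦ (mem_idxJ.1 hj).1 i
    have hlt : d - 1 < η - ∑ i, j i := by
      simp only [mem_filter, hj, true_and] at hj'
      omega
    rw [Nat.choose_eq_zero_of_lt hlt, Nat.cast_zero, mul_zero, zero_mul]
  have hdiff (i : Fin d) (n : ℕ) :
      PowerSeries.coeff n ((1 - PowerSeries.X) * PowerSeries.mk (u i)) =
        u i n - u i (n - 1) := by
    cases n with
    | zero => simp [sub_mul, hu]
    | succ n => simp [sub_mul, PowerSeries.coeff_succ_X_mul]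
  have hL := sum_idxJ_coeff_mul_prod_coeff d η (PowerSeries.mk 1)
    (fun i ↦ (1 - PowerSeries.X) * PowerSeries.mk (u i)) fun i ↦ by simp [hu]
  have hR := sum_idxJ_coeff_mul_prod_coeff d η ((1 - PowerSeries.X) ^ (d - 1))
    (fun i ↦ PowerSeries.mk (u i)) fun i ↦ by simp [hu]
  simp only [hdiff, PowerSeries.coeff_mk, Pi.one_apply, one_mul] at hL
  simp only [coeff_one_sub_X_pow, PowerSeries.coeff_mk] at hR
  rw [hP, hL, hR, prod_mul_distrib, prod_const, card_univ, Fintype.card_fin, ← mul_assoc,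
    ← mul_pow_sub_one (by omega : d ≠ 0), ← mul_assoc, PowerSeries.mk_one_mul_one_sub_eq_one,
    one_mul]
end

section
/- Sample size, Table 1 row 1 (bound): Let c ≥ 1 be an integer and suppose the component designs satisfy #X_{i,j} = c·j for all i = 1,…,d and all j ≥ 1. Then d! · #X_SG(η) ≤ (c·η)^d; that is, #X_SG(η) ≤ (cη)^d / d!. -/
open Finset

noncomputable section

/-- Multi-indices `j ∈ ℕ^d` with all entries at least 1 and `∑ j i = η`. -/
def idxE (d η : ℕ) : Finset (Fin d → ℕ) :=
  (Fintype.piFinset fun _ : Fin d => Finset.Icc 1 η).filter fun j => ∑ i, j i = η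

/-- The lattice design `X_{1,j_1} × ⋯ × X_{d,j_d}`. -/
def lattice {d : ℕ} (X : Fin d → ℕ → Finset ℝ) (j : Fin d → ℕ) : Finset (Fin d → ℝ) :=
  Fintype.piFinset fun i => X i (j i)

/-- The sparse grid design `X_SG(η)`. -/
def sparseGrid {d : ℕ} (X : Fin d → ℕ → Finset ℝ) (η : ℕ) : Finset (Fin d → ℝ) :=
  (idxE d η).biUnion fun j => lattice X j

/-- Multi-indices with all entries at least 1 and sum at most `η`. -/
def idxLE (d η : ℕ) : Finset (Fin d → ℕ) :=
  (Fintype.piFinset fun _ : Fin d => Finset.Icc 1 η).filter fun j => ∑ i, j i ≤ η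

theorem mem_idxLE {d η : ℕ} {j : Fin d → ℕ} :
    j ∈ idxLE d η ↔ (∀ i, 1 ≤ j i) ∧ ∑ i, j i ≤ η := by
  simp only [idxLE, mem_filter, Fintype.mem_piFinset, mem_Icc]
  refine ⟨fun h => ⟨fun i => (h.1 i).1, h.2⟩, fun h => ⟨fun i => ⟨h.1 i, ?_⟩, h.2⟩⟩
  exact (single_le_sum (f := j) (fun _ _ => Nat.zero_le _) (mem_univ i)).trans h.2

theorem card_idxLE_succ_le (d η : ℕ) :
    (idxLE (d + 1) η).card ≤ ∑ m ∈ range η, (idxLE d m).card := by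
  have hmaps : ∀ j ∈ idxLE (d + 1) η, η - j 0 ∈ range η := by
    intro j hj
    obtain ⟨h1, h2⟩ := mem_idxLE.1 hj
    have := h1 0
    rw [Fin.sum_univ_succ] at h2
    rw [mem_range]
    omega
  rw [card_eq_sum_card_fiberwise hmaps]
  refine sum_le_sum fun m _ => card_le_card_of_injOn Fin.tail ?_ ?_
  · intro j hj
    obtain ⟨hmem, rfl⟩ := mem_filter.1 hj
    obtain ⟨h1, h2⟩ := mem_idxLE.1 hmem
    rw [Fin.sum_univ_succ] at h2
    exact mem_idxLE.2 ⟨fun i => h1 i.succ, Nat.le_sub_of_add_le' h2⟩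
  · intro j hj k hk hjk
    obtain ⟨hj, hjm⟩ := mem_filter.1 hj
    obtain ⟨hk, hkm⟩ := mem_filter.1 hk
    have hj2 := (mem_idxLE.1 hj).2
    have hk2 := (mem_idxLE.1 hk).2
    rw [Fin.sum_univ_succ] at hj2 hk2
    have h0 : j 0 = k 0 := by omega
    rw [← Fin.cons_self_tail j, ← Fin.cons_self_tail k, h0, hjk]

theorem succ_mul_sum_range_pow_le (d η : ℕ) :
    (d + 1) * ∑ m ∈ range η, m ^ d ≤ η ^ (d + 1) := by
  induction η with
  | zero => simp
  | succ n ih =>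
    rw [sum_range_succ, mul_add]
    have h : n ^ (d + 1) + (d + 1) * n ^ d ≤ (n + 1) ^ (d + 1) := by
      simpa using pow_add_mul_le_add_pow_of_sq_nonneg (a := n) (b := 1) (by positivity)
        (by positivity) (by positivity) (by positivity) (d + 1)
    omega

theorem factorial_mul_card_idxLE_le (d η : ℕ) :
    d.factorial * (idxLE d η).card ≤ η ^ d := by
  induction d generalizing η with
  | zero => simpa using card_le_one_of_subsingleton (idxLE 0 η)
  | succ d ih =>
    calc (d + 1).factorial * (idxLE (d + 1) η).card
        ≤ (d + 1).factorial * ∑ m ∈ range η, (idxLE d m).card :=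
          Nat.mul_le_mul_left _ (card_idxLE_succ_le d η)
      _ = (d + 1) * ∑ m ∈ range η, d.factorial * (idxLE d m).card := by
          rw [Nat.factorial_succ, mul_assoc, mul_sum]
      _ ≤ (d + 1) * ∑ m ∈ range η, m ^ d := by
          gcongr with m _
          exact ih m
      _ ≤ η ^ (d + 1) := succ_mul_sum_range_pow_le d η

/-- The sparse grid is covered by the products of increments of the component designs. -/
theorem sparseGrid_subset_biUnion_increments {d : ℕ} (η : ℕ) (X : Fin d → ℕ → Finset ℝ)
    (hX0 : ∀ i, X i 0 = ∅) :
    sparseGrid X η ⊆ (idxLE d η).biUnion fun l =>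
      Fintype.piFinset fun i => X i (l i) \ X i (l i - 1) := by
  classical
  intro x hx
  obtain ⟨j, hj, hxj⟩ := mem_biUnion.1 hx
  have hxj : ∀ i, x i ∈ X i (j i) := Fintype.mem_piFinset.1 hxj
  have hex : ∀ i, ∃ n, x i ∈ X i n := fun i => ⟨j i, hxj i⟩
  have hpos : ∀ i, 1 ≤ Nat.find (hex i) := fun i => by
    rw [Nat.one_le_iff_ne_zero, Ne, Nat.find_eq_zero, hX0]
    exact notMem_empty _
  refine mem_biUnion.2 ⟨fun i => Nat.find (hex i), mem_idxLE.2 ⟨hpos, ?_⟩,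
    Fintype.mem_piFinset.2 fun i => mem_sdiff.2 ⟨Nat.find_spec (hex i), ?_⟩⟩
  · exact (sum_le_sum fun i _ => Nat.find_min' (hex i) (hxj i)).trans (mem_filter.1 hj).2.le
  · exact Nat.find_min (hex i) (Nat.sub_lt (hpos i) one_pos)

/-- Sample size, Table 1 row 1 (bound): if `#X_{i,j} = c·j` then `#X_SG(η) ≤ (cη)^d / d!`,
i.e. `d! · #X_SG(η) ≤ (c·η)^d`. -/
theorem sample_size_row1_bound (d η : ℕ) (hd : 1 ≤ d) (hη : d ≤ η)
    (X : Fin d → ℕ → Finset ℝ) (hX0 : ∀ i, X i 0 = ∅)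
    (hnest : ∀ i j, X i j ⊆ X i (j + 1))
    (c : ℕ) (hc : 1 ≤ c) (hcard : ∀ (i : Fin d) (j : ℕ), 1 ≤ j → (X i j).card = c * j) :
    d.factorial * (sparseGrid X η).card ≤ (c * η) ^ d := by
  have hincr : ∀ i l, 1 ≤ l → (X i l \ X i (l - 1)).card = c := by
    intro i l hl
    obtain ⟨n, rfl⟩ := Nat.exists_eq_add_of_le' hl
    have hn : (X i n).card = c * n := by
      rcases Nat.eq_zero_or_pos n with rfl | hn
      · simp [hX0]
      · exact hcard i n hn
    rw [Nat.add_sub_cancel, card_sdiff_of_subset (hnest i n), hcard i _ hl, hn, mul_add, mul_one,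
      Nat.add_sub_cancel_left]
  have hcover : (sparseGrid X η).card ≤ (idxLE d η).card * c ^ d := by
    refine (card_le_card (sparseGrid_subset_biUnion_increments η X hX0)).trans
      (card_biUnion_le_card_mul _ _ _ fun l hl => ?_)
    rw [Fintype.card_piFinset, prod_congr rfl fun i _ => hincr i _ ((mem_idxLE.1 hl).1 i)]
    simp
  calc d.factorial * (sparseGrid X η).card
      ≤ d.factorial * ((idxLE d η).card * c ^ d) := Nat.mul_le_mul_left _ hcover
    _ = c ^ d * (d.factorial * (idxLE d η).card) := by ring
    _ ≤ c ^ d * η ^ d := Nat.mul_le_mul_left _ (factorial_mul_card_idxLE_le d η)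
    _ = (c * η) ^ d := (mul_pow c η d).symm
end
end

section
/- Sample size, Table 1 row 3 (exact): Let c_0 ≥ 1 and c ≥ 2 be integers and suppose the component designs satisfy #X_{i,j} = c_0·(c^j − 1) for all i = 1,…,d and all j ≥ 1. Then #X_SG(η) = c_0^d · (c−1)^d · Σ_{m=0}^{η−d} c^m · binom(m + d − 1, d − 1). -/
open Finset

noncomputable section

/-- Stars and bars for functions `Fin d → ℕ` with prescribed sum. -/
theorem card_piAntidiag_univ_fin (d m : ℕ) (hd : 1 ≤ d) :
    (piAntidiag (univ : Finset (Fin d)) m).card = (m + d - 1).choose (d - 1) := by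
  rw [← map_sym_eq_piAntidiag, card_map, sym_univ, card_univ, Sym.card_sym_eq_choose,
    Fintype.card_fin, Nat.add_comm d m]
  exact Nat.choose_symm_of_eq_add (by omega)

/-- The points whose `i`-th coordinate first appears in the component design of level `k i + 1`. -/
def levelCell {d : ℕ} (X : Fin d → ℕ → Finset ℝ) (k : Fin d → ℕ) : Finset (Fin d → ℝ) :=
  Fintype.piFinset fun i => X i (k i + 1) \ X i (k i)

theorem mem_levelCell {d : ℕ} {X : Fin d → ℕ → Finset ℝ} {k : Fin d → ℕ} {x : Fin d → ℝ} :
    x ∈ levelCell X k ↔ ∀ i, x i ∈ X i (k i + 1) ∧ x i ∉ X i (k i) := by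
  simp [levelCell]

theorem disjoint_levelCell {d : ℕ} {X : Fin d → ℕ → Finset ℝ} (hmono : ∀ i, Monotone (X i))
    {k l : Fin d → ℕ} (hkl : k ≠ l) : Disjoint (levelCell X k) (levelCell X l) := by
  refine Finset.disjoint_left.2 fun x hk hl => hkl ?_
  rw [mem_levelCell] at hk hl
  funext i
  by_contra hne
  rcases Nat.lt_or_gt_of_ne hne with h | h
  · exact (hl i).2 (hmono i h (hk i).1)
  · exact (hk i).2 (hmono i h (hl i).1)

theorem card_levelCell {d : ℕ} {X : Fin d → ℕ → Finset ℝ} (hX0 : ∀ i, X i 0 = ∅)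
    (hnest : ∀ i j, X i j ⊆ X i (j + 1)) {c₀ c : ℕ}
    (hcard : ∀ (i : Fin d) (j : ℕ), 1 ≤ j → (X i j).card = c₀ * (c ^ j - 1)) (k : Fin d → ℕ) :
    (levelCell X k).card = c₀ ^ d * (c - 1) ^ d * c ^ ∑ i, k i := by
  have hcard' (i : Fin d) (j : ℕ) : (X i j).card = c₀ * (c ^ j - 1) := by
    rcases Nat.eq_zero_or_pos j with rfl | hj
    · simp [hX0]
    · exact hcard i j hj
  have hstep (i : Fin d) (j : ℕ) : (X i (j + 1) \ X i j).card = c₀ * (c - 1) * c ^ j := by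
    rw [card_sdiff_of_subset (hnest i j), hcard', hcard', ← Nat.mul_sub, mul_assoc]
    congr 1
    rcases Nat.eq_zero_or_pos c with rfl | hc
    · rcases j with _ | j <;> simp
    · have := Nat.one_le_pow j c hc
      rw [Nat.sub_mul, one_mul, pow_succ, Nat.mul_comm c]
      omega
  rw [levelCell, Fintype.card_piFinset]
  simp only [hstep, prod_mul_distrib, prod_const, prod_pow_eq_pow_sum, card_univ,
    Fintype.card_fin]

theorem mem_idxE {d η : ℕ} {j : Fin d → ℕ} :
    j ∈ idxE d η ↔ (∀ i, 1 ≤ j i) ∧ ∑ i, j i = η := by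
  simp only [idxE, mem_filter, Fintype.mem_piFinset, mem_Icc]
  refine ⟨fun h => ⟨fun i => (h.1 i).1, h.2⟩, fun h => ⟨fun i => ⟨h.1 i, ?_⟩, h.2⟩⟩
  exact h.2 ▸ single_le_sum (fun _ _ => Nat.zero_le _) (mem_univ i)

theorem sparseGrid_eq_biUnion_levelCell {d η : ℕ} (hd : 1 ≤ d) (hη : d ≤ η)
    {X : Fin d → ℕ → Finset ℝ} (hX0 : ∀ i, X i 0 = ∅) (hmono : ∀ i, Monotone (X i)) :
    sparseGrid X η =
      ((range (η - d + 1)).biUnion fun m => piAntidiag univ m).biUnion (levelCell X) := by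
  ext x
  simp only [sparseGrid, lattice, mem_biUnion, mem_idxE, Fintype.mem_piFinset, mem_range,
    mem_piAntidiag, mem_univ, implies_true, and_true, mem_levelCell]
  constructor
  · rintro ⟨j, ⟨-, hsum⟩, hx⟩
    have hlevel (i : Fin d) : ∃ k, k + 1 ≤ j i ∧ x i ∈ X i (k + 1) ∧ x i ∉ X i k := by
      classical
      have hex : ∃ n, x i ∈ X i n := ⟨j i, hx i⟩
      have hpos : Nat.find hex ≠ 0 := fun h => by
        have := Nat.find_spec hex
        simp [h, hX0] at this
      obtain ⟨k, hk⟩ := Nat.exists_eq_succ_of_ne_zero hpos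
      exact ⟨k, hk.symm.le.trans (Nat.find_min' hex (hx i)),
        Nat.succ_eq_add_one k ▸ hk ▸ Nat.find_spec hex, Nat.find_min hex (by omega)⟩
    choose k hkj hk using hlevel
    have hle : ∑ i, (k i + 1) ≤ ∑ i, j i := sum_le_sum fun i _ => hkj i
    rw [sum_add_distrib, hsum] at hle
    simp only [sum_const, card_univ, Fintype.card_fin, smul_eq_mul, mul_one] at hle
    exact ⟨k, ⟨∑ i, k i, by omega, rfl⟩, hk⟩
  · rintro ⟨k, ⟨m, hm, hsum⟩, hk⟩
    refine ⟨fun i => k i + 1 + if i = ⟨0, hd⟩ then η - d - m else 0,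
      ⟨fun i => (Nat.le_add_left 1 (k i)).trans (Nat.le_add_right _ _), ?_⟩,
      fun i => hmono i (Nat.le_add_right _ _) (hk i).1⟩
    simp only [sum_add_distrib, hsum, sum_const, card_univ, Fintype.card_fin, smul_eq_mul,
      mul_one, sum_ite_eq', mem_univ, if_true]
    omega

/-- Sample size, Table 1 row 3 (exact): if `#X_{i,j} = c₀·(c^j − 1)` then
`#X_SG(η) = c₀^d (c−1)^d Σ_{m=0}^{η−d} c^m · C(m+d−1, d−1)`. -/
theorem sample_size_row3_exact (d η : ℕ) (hd : 1 ≤ d) (hη : d ≤ η)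
    (X : Fin d → ℕ → Finset ℝ) (hX0 : ∀ i, X i 0 = ∅)
    (hnest : ∀ i j, X i j ⊆ X i (j + 1))
    (c₀ c : ℕ) (hc₀ : 1 ≤ c₀) (hc : 2 ≤ c)
    (hcard : ∀ (i : Fin d) (j : ℕ), 1 ≤ j → (X i j).card = c₀ * (c ^ j - 1)) :
    (sparseGrid X η).card =
      c₀ ^ d * (c - 1) ^ d *
        ∑ m ∈ Finset.range (η - d + 1), c ^ m * (m + d - 1).choose (d - 1) := by
  have hmono (i : Fin d) : Monotone (X i) := monotone_nat_of_le_succ (hnest i)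
  rw [sparseGrid_eq_biUnion_levelCell hd hη hX0 hmono,
    card_biUnion fun k _ l _ hkl => disjoint_levelCell hmono hkl, sum_biUnion, mul_sum]
  · refine sum_congr rfl fun m _ => ?_
    rw [← card_piAntidiag_univ_fin d m hd, ← mul_assoc, mul_comm, ← smul_eq_mul]
    refine sum_eq_card_nsmul fun k hk => ?_
    rw [card_levelCell hX0 hnest hcard, (mem_piAntidiag.1 hk).1]
  · refine fun m _ n _ hmn => Finset.disjoint_left.2 fun k hm hn => hmn ?_
    rw [← (mem_piAntidiag.1 hm).1, (mem_piAntidiag.1 hn).1]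
end
end
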